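/- arXiv:1606.02158 — 2 statements merged into one kernel-verified Lean document; each statement's English description precedes it below -/
import Mathlib

section
/- Let f : ℝ^N → [0,∞) be measurable with limsup_{|x|→∞} f(x)|x|^γ < ∞ for some γ with α < γ < N, and suppose f is bounded. Then limsup_{|x|→∞} (I_α ∗ f)(x) |x|^{γ-α} < ∞. -/
open MeasureTheory ENNReal Filter

/-- The normalisation constant `A_α` of the Riesz potential on `ℝ^N`. -/
noncomputable def rieszConst (N : ℕ) (α : ℝ) : ℝ :=
  Real.Gamma (((N : ℝ) - α) / 2) / (Real.Gamma (α / 2) * Real.pi ^ ((N : ℝ) / 2) * 2 ^ α)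

/-- The Riesz potential `I_α ∗ f` of a function, as a `[0,∞]`-valued integral. -/
noncomputable def rieszConv (N : ℕ) (α : ℝ) (f : EuclideanSpace ℝ (Fin N) → ℝ)
    (x : EuclideanSpace ℝ (Fin N)) : ℝ≥0∞ :=
  ∫⁻ y, ENNReal.ofReal (rieszConst N α * f y / ‖x - y‖ ^ ((N : ℝ) - α))

lemma aux_H_int (N : ℕ) (hN : 1 ≤ N) (p : ℝ) (hp : p < N) :
    ∫⁻ z : EuclideanSpace ℝ (Fin N),
      ENNReal.ofReal ((Metric.ball (0 : EuclideanSpace ℝ (Fin N)) 1).indicator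
        (fun z => ‖z‖ ^ (-p)) z) < ⊤ := by
  have h : IntegrableOn (fun z : EuclideanSpace ℝ (Fin N) => ‖z‖ ^ (-p))
      (Metric.ball 0 1) volume := by
    refine integrableOn_ball_of_norm_le_rpow (C := 1) (α := p) ?_ ?_ ?_ ?_
    · simpa using hN
    · simpa using hp
    · refine Eventually.of_forall fun x => ?_
      rw [one_mul, Real.norm_of_nonneg (by positivity)]
    · exact (measurable_norm.pow_const _).aestronglyMeasurable
  have h2 := (integrable_indicator_iff measurableSet_ball).2 h
  exact h2.lintegral_lt_top

lemma aux_pointwise (N : ℕ) (γ δ : ℝ) (hγ : 0 < γ) (hδ : 0 < δ)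
    (e z : EuclideanSpace ℝ (Fin N)) (he : ‖e‖ = 1) :
    ‖z‖ ^ (-γ) * ‖e - z‖ ^ (-δ) ≤
      2 ^ δ * (Metric.ball (0 : EuclideanSpace ℝ (Fin N)) 1).indicator
        (fun z => ‖z‖ ^ (-γ)) z +
      2 ^ γ * (Metric.ball (0 : EuclideanSpace ℝ (Fin N)) 1).indicator
        (fun z => ‖z‖ ^ (-δ)) (e - z) +
      5 ^ (γ + δ) * (1 + ‖z‖) ^ (-(γ + δ)) := by
  have t1 : ‖e‖ ≤ ‖e - z‖ + ‖z‖ := norm_le_norm_sub_add e z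
  have t2 : ‖z‖ ≤ ‖e - z‖ + ‖e‖ := by
    have := norm_le_norm_sub_add z e
    rwa [norm_sub_rev] at this
  rw [he] at t1 t2
  have n1 := norm_nonneg z
  have n2 := norm_nonneg (e - z)
  have i1 : 0 ≤ (Metric.ball (0 : EuclideanSpace ℝ (Fin N)) 1).indicator
        (fun z => ‖z‖ ^ (-γ)) z := Set.indicator_nonneg (fun _ _ => by positivity) _
  have i2 : 0 ≤ (Metric.ball (0 : EuclideanSpace ℝ (Fin N)) 1).indicator
        (fun z => ‖z‖ ^ (-δ)) (e - z) := Set.indicator_nonneg (fun _ _ => by positivity) _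
  have key : ∀ (c p t : ℝ), 0 < c → 0 ≤ p → c⁻¹ ≤ t → t ^ (-p) ≤ c ^ p := by
    intro c p t hc hp ht
    have := Real.rpow_le_rpow_of_nonpos (inv_pos.2 hc) ht (neg_nonpos.2 hp)
    rwa [Real.inv_rpow hc.le, Real.rpow_neg hc.le, inv_inv] at this
  have key2 : ∀ (p t : ℝ), 0 ≤ p → (1 + ‖z‖) / 5 ≤ t →
      t ^ (-p) ≤ 5 ^ p * (1 + ‖z‖) ^ (-p) := by
    intro p t hp ht
    have := Real.rpow_le_rpow_of_nonpos (by positivity) ht (neg_nonpos.2 hp)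
    rw [Real.div_rpow (by positivity) (by norm_num), Real.rpow_neg (by norm_num : (0:ℝ) ≤ 5),
      div_inv_eq_mul, mul_comm] at this
    exact this
  by_cases h1 : ‖z‖ < 1 / 2
  · have hz : z ∈ Metric.ball (0 : EuclideanSpace ℝ (Fin N)) 1 := by
      rw [mem_ball_zero_iff]; linarith
    have b := key 2 δ ‖e - z‖ (by norm_num) hδ.le (by linarith)
    have : ‖z‖ ^ (-γ) * ‖e - z‖ ^ (-δ) ≤ ‖z‖ ^ (-γ) * 2 ^ δ := by gcongr
    rw [Set.indicator_of_mem hz]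
    have : 0 ≤ 2 ^ γ * (Metric.ball (0 : EuclideanSpace ℝ (Fin N)) 1).indicator
        (fun z => ‖z‖ ^ (-δ)) (e - z) := by positivity
    have : 0 ≤ 5 ^ (γ + δ) * (1 + ‖z‖) ^ (-(γ + δ)) := by positivity
    linarith
  by_cases h2 : ‖e - z‖ < 1 / 2
  · have hz : e - z ∈ Metric.ball (0 : EuclideanSpace ℝ (Fin N)) 1 := by
      rw [mem_ball_zero_iff]; linarith
    have b := key 2 γ ‖z‖ (by norm_num) hγ.le (by linarith)
    have : ‖z‖ ^ (-γ) * ‖e - z‖ ^ (-δ) ≤ 2 ^ γ * ‖e - z‖ ^ (-δ) := by gcongr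
    rw [Set.indicator_of_mem hz]
    have : 0 ≤ 2 ^ δ * (Metric.ball (0 : EuclideanSpace ℝ (Fin N)) 1).indicator
        (fun z => ‖z‖ ^ (-γ)) z := by positivity
    have : 0 ≤ 5 ^ (γ + δ) * (1 + ‖z‖) ^ (-(γ + δ)) := by positivity
    linarith
  · push Not at h1 h2
    have b1 := key2 γ ‖z‖ hγ.le (by linarith)
    have b2 := key2 δ ‖e - z‖ hδ.le (by linarith)
    have : ‖z‖ ^ (-γ) * ‖e - z‖ ^ (-δ) ≤
        (5 ^ γ * (1 + ‖z‖) ^ (-γ)) * (5 ^ δ * (1 + ‖z‖) ^ (-δ)) := by gcongr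
    have e1 : (5 ^ γ * (1 + ‖z‖) ^ (-γ)) * (5 ^ δ * (1 + ‖z‖) ^ (-δ)) =
        5 ^ (γ + δ) * (1 + ‖z‖) ^ (-(γ + δ)) := by
      rw [Real.rpow_add (by norm_num), neg_add, Real.rpow_add (by positivity)]
      ring
    have : 0 ≤ 2 ^ δ * (Metric.ball (0 : EuclideanSpace ℝ (Fin N)) 1).indicator
        (fun z => ‖z‖ ^ (-γ)) z := by positivity
    have : 0 ≤ 2 ^ γ * (Metric.ball (0 : EuclideanSpace ℝ (Fin N)) 1).indicator
        (fun z => ‖z‖ ^ (-δ)) (e - z) := by positivity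
    linarith

lemma aux_unit (N : ℕ) (hN : 1 ≤ N) (γ δ : ℝ) (hγ : 0 < γ) (hδ : 0 < δ) (hγN : γ < N)
    (hδN : δ < N) (hs : N < γ + δ) :
    ∃ C : ℝ≥0∞, C < ⊤ ∧ ∀ e : EuclideanSpace ℝ (Fin N), ‖e‖ = 1 →
      ∫⁻ z, ENNReal.ofReal (‖z‖ ^ (-γ) * ‖e - z‖ ^ (-δ)) ≤ C := by
  have hA := aux_H_int N hN γ hγN
  have hB := aux_H_int N hN δ hδN
  have hC : ∫⁻ z : EuclideanSpace ℝ (Fin N),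
      ENNReal.ofReal ((1 + ‖z‖) ^ (-(γ + δ))) < ⊤ :=
    (integrable_one_add_norm (by simpa using hs)).lintegral_lt_top
  have mH : ∀ p : ℝ, Measurable (fun z : EuclideanSpace ℝ (Fin N) =>
      ENNReal.ofReal ((Metric.ball (0 : EuclideanSpace ℝ (Fin N)) 1).indicator
        (fun z => ‖z‖ ^ (-p)) z)) := fun p =>
    ((measurable_norm.pow_const _).indicator measurableSet_ball).ennreal_ofReal
  refine ⟨ENNReal.ofReal (2 ^ δ) * _ + ENNReal.ofReal (2 ^ γ) * _ +
    ENNReal.ofReal (5 ^ (γ + δ)) * _, ENNReal.add_lt_top.2 ⟨ENNReal.add_lt_top.2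
      ⟨ENNReal.mul_lt_top ENNReal.ofReal_lt_top hA, ENNReal.mul_lt_top ENNReal.ofReal_lt_top hB⟩,
      ENNReal.mul_lt_top ENNReal.ofReal_lt_top hC⟩, fun e he => ?_⟩
  have mE : Measurable (fun z : EuclideanSpace ℝ (Fin N) =>
      ENNReal.ofReal ((Metric.ball (0 : EuclideanSpace ℝ (Fin N)) 1).indicator
        (fun z => ‖z‖ ^ (-δ)) (e - z))) :=
    (mH δ).comp (measurable_const.sub measurable_id)
  rw [← lintegral_sub_left_eq_self (fun z : EuclideanSpace ℝ (Fin N) =>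
      ENNReal.ofReal ((Metric.ball (0 : EuclideanSpace ℝ (Fin N)) 1).indicator
        (fun z => ‖z‖ ^ (-δ)) z)) e, ← lintegral_const_mul _ (mH γ),
    ← lintegral_const_mul _ mE,
    ← lintegral_const_mul _ (by fun_prop), ← lintegral_add_left ((mH γ).const_mul _),
    ← lintegral_add_left]
  · refine lintegral_mono fun z => ?_
    refine (ENNReal.ofReal_le_ofReal (aux_pointwise N γ δ hγ hδ e z he)).trans ?_
    refine ENNReal.ofReal_add_le.trans (add_le_add (ENNReal.ofReal_add_le.trans
      (add_le_add ?_ ?_)) ?_) <;> exact (ENNReal.ofReal_mul (by positivity)).le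
  · exact ((mH γ).const_mul _).add (mE.const_mul _)

lemma aux_scale (N : ℕ) (g : EuclideanSpace ℝ (Fin N) → ℝ≥0∞) (r : ℝ)
    (hr : 0 < r) : ∫⁻ y, g y = ENNReal.ofReal (r ^ (N : ℝ)) * ∫⁻ z, g (r • z) := by
  have h := Measure.map_addHaar_smul (volume : Measure (EuclideanSpace ℝ (Fin N))) hr.ne'
  have h3 : ∫⁻ z, g (r • z) = ∫⁻ y, g y ∂(Measure.map (r • ·) volume) :=
    (lintegral_map_equiv g (Homeomorph.smulOfNeZero r hr.ne').toMeasurableEquiv).symm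
  rw [h3, h, lintegral_smul_measure, smul_eq_mul, ← mul_assoc,
    ← ENNReal.ofReal_mul (by positivity)]
  have : r ^ (N : ℝ) * |(r ^ Module.finrank ℝ (EuclideanSpace ℝ (Fin N)))⁻¹| = 1 := by
    rw [abs_of_pos (by positivity), Real.rpow_natCast, finrank_euclideanSpace_fin]
    field_simp
  rw [this]; simp

/-- If `f ≥ 0` is bounded and `limsup_{|x|→∞} f(x)|x|^γ < ∞` for some `α < γ < N`, then
`limsup_{|x|→∞} (I_α ∗ f)(x)|x|^{γ-α} < ∞`. -/
theorem stmt8 (N : ℕ) (hN : 1 ≤ N) (α γ : ℝ) (hα : 0 < α) (hαγ : α < γ) (hγN : γ < N)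
    (f : EuclideanSpace ℝ (Fin N) → ℝ) (hmeas : Measurable f) (hf0 : ∀ x, 0 ≤ f x)
    (hbd : ∃ M : ℝ, ∀ x, f x ≤ M)
    (hlim : Filter.limsup (fun x => ENNReal.ofReal (f x * ‖x‖ ^ γ))
      (Bornology.cobounded (EuclideanSpace ℝ (Fin N))) < ⊤) :
    Filter.limsup (fun x => rieszConv N α f x * ENNReal.ofReal (‖x‖ ^ (γ - α)))
      (Bornology.cobounded (EuclideanSpace ℝ (Fin N))) < ⊤ := by
  obtain ⟨M, hM⟩ := hbd
  have hM0 : 0 ≤ M := (hf0 0).trans (hM 0)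
  have hγ : 0 < γ := hα.trans hαγ
  -- global pointwise bound
  obtain ⟨K, hK0, hK⟩ : ∃ K : ℝ, 0 ≤ K ∧ ∀ y, y ≠ 0 → f y ≤ K * ‖y‖ ^ (-γ) := by
    obtain ⟨C, hC1, hC2⟩ := exists_between hlim
    have ev := eventually_lt_of_limsup_lt hC1
    obtain ⟨R, -, hR⟩ := Filter.hasBasis_cobounded_norm.eventually_iff.1 ev
    refine ⟨max C.toReal (M * |R| ^ γ), le_max_of_le_left ENNReal.toReal_nonneg, fun y hy => ?_⟩
    have hy' : 0 < ‖y‖ := norm_pos_iff.2 hy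
    rw [Real.rpow_neg hy'.le, ← div_eq_mul_inv, le_div_iff₀ (by positivity)]
    by_cases h : R ≤ ‖y‖
    · refine le_max_of_le_left ?_
      exact (ENNReal.ofReal_le_iff_le_toReal hC2.ne).1 (hR h).le
    · refine le_max_of_le_right ?_
      push Not at h
      have : ‖y‖ ≤ |R| := h.le.trans (le_abs_self R)
      have := hM y
      gcongr
  obtain ⟨C, hC, hCe⟩ := aux_unit N hN γ (N - α) hγ (by linarith) hγN (by linarith) (by linarith)
  set A := |rieszConst N α| with hA
  have hA0 : 0 ≤ A := abs_nonneg _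
  have : Nonempty (Fin N) := ⟨⟨0, hN⟩⟩
  refine lt_of_le_of_lt (limsup_le_of_le (a := ENNReal.ofReal (A * K) * C) (by isBoundedDefault) ?_)
    (ENNReal.mul_lt_top ENNReal.ofReal_lt_top hC)
  refine Filter.hasBasis_cobounded_norm.eventually_iff.2 ⟨1, trivial, fun x hx => ?_⟩
  have hx : 1 ≤ ‖x‖ := hx
  have hr : 0 < ‖x‖ := by linarith
  set r := ‖x‖ with hrdef
  set e := r⁻¹ • x with he
  have hxe : x = r • e := by rw [he, smul_inv_smul₀ hr.ne']
  have hen : ‖e‖ = 1 := by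
    rw [he, norm_smul, norm_inv, Real.norm_of_nonneg hr.le, ← hrdef, inv_mul_cancel₀ hr.ne']
  have step1 : rieszConv N α f x ≤
      ∫⁻ y, ENNReal.ofReal (A * K) * ENNReal.ofReal (‖y‖ ^ (-γ) * ‖x - y‖ ^ (-((N : ℝ) - α))) := by
    unfold rieszConv
    refine lintegral_mono_ae ?_
    have h0 : ∀ᵐ y : EuclideanSpace ℝ (Fin N), y ≠ 0 := Measure.ae_ne volume 0
    filter_upwards [h0] with y hy
    rw [← ENNReal.ofReal_mul (by positivity)]
    apply ENNReal.ofReal_le_ofReal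
    rw [div_eq_mul_inv, ← Real.rpow_neg (norm_nonneg _), ← mul_assoc, mul_assoc A]
    have := hK y hy
    have h1 : rieszConst N α * f y ≤ A * f y :=
      mul_le_mul_of_nonneg_right (le_abs_self _) (hf0 y)
    have h2 : A * f y ≤ A * (K * ‖y‖ ^ (-γ)) := mul_le_mul_of_nonneg_left this hA0
    exact mul_le_mul_of_nonneg_right (h1.trans h2) (by positivity)
  have step2 : ∫⁻ y, ENNReal.ofReal (‖y‖ ^ (-γ) * ‖x - y‖ ^ (-((N : ℝ) - α))) ≤
      ENNReal.ofReal (r ^ (α - γ)) * C := by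
    rw [aux_scale N _ r hr]
    have : ∀ z : EuclideanSpace ℝ (Fin N),
        ENNReal.ofReal (‖r • z‖ ^ (-γ) * ‖x - r • z‖ ^ (-((N : ℝ) - α))) =
        ENNReal.ofReal (r ^ (-γ) * r ^ (-((N : ℝ) - α))) *
          ENNReal.ofReal (‖z‖ ^ (-γ) * ‖e - z‖ ^ (-((N : ℝ) - α))) := by
      intro z
      rw [← ENNReal.ofReal_mul (by positivity)]
      congr 1
      have : x - r • z = r • (e - z) := by rw [smul_sub, ← hxe]
      rw [this, norm_smul, norm_smul, Real.norm_of_nonneg hr.le,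
        Real.mul_rpow hr.le (norm_nonneg _), Real.mul_rpow hr.le (norm_nonneg _)]
      ring
    simp_rw [this]
    rw [lintegral_const_mul' _ _ ENNReal.ofReal_ne_top, ← mul_assoc,
      ← ENNReal.ofReal_mul (by positivity), ← Real.rpow_add hr, ← Real.rpow_add hr]
    have e1 : (N : ℝ) + (-γ + -((N : ℝ) - α)) = α - γ := by ring
    rw [e1]
    gcongr
    exact hCe e hen
  rw [lintegral_const_mul' _ _ ENNReal.ofReal_ne_top] at step1
  calc rieszConv N α f x * ENNReal.ofReal (r ^ (γ - α))
      ≤ ENNReal.ofReal (A * K) * (ENNReal.ofReal (r ^ (α - γ)) * C) *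
          ENNReal.ofReal (r ^ (γ - α)) := by
        gcongr
        exact step1.trans (by gcongr)
    _ = ENNReal.ofReal (A * K) * C *
          (ENNReal.ofReal (r ^ (α - γ)) * ENNReal.ofReal (r ^ (γ - α))) := by ring
    _ = ENNReal.ofReal (A * K) * C := by
        rw [← ENNReal.ofReal_mul (by positivity), ← Real.rpow_add hr]
        simp
end

section
/- Let N ≥ 3, α ∈ (0,N), ρ > 0 and 0 < p ≤ α/(N-2). If u is a nonnegative classical solution of -Δu ≥ (I_α ∗ u^p) u^q in ℝ^N \ B_ρ with u ∈ L^p(ℝ^N \ B_ρ, |x|^{-(N-α)}dx) (so that I_α ∗ u^p < ∞ a.e.), then u ≡ 0. -/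
open MeasureTheory ENNReal

/-- The Laplacian of `u : ℝ^N → ℝ` as a sum of second partial derivatives. -/
noncomputable def laplacian (N : ℕ) (u : EuclideanSpace ℝ (Fin N) → ℝ)
    (x : EuclideanSpace ℝ (Fin N)) : ℝ :=
  ∑ i : Fin N,
    fderiv ℝ (fun y => fderiv ℝ u y (EuclideanSpace.single i 1)) x (EuclideanSpace.single i 1)

/-- The Riesz potential `I_α ∗ (u^p)` in the exterior domain `{|y| ≥ ρ}`
(`u^p` extended by `0` inside `B_ρ`). -/
noncomputable def rieszConvExt (N : ℕ) (α ρ p : ℝ) (u : EuclideanSpace ℝ (Fin N) → ℝ)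
    (x : EuclideanSpace ℝ (Fin N)) : ℝ≥0∞ :=
  ∫⁻ y in {y : EuclideanSpace ℝ (Fin N) | ρ ≤ ‖y‖},
    ENNReal.ofReal (rieszConst N α * u y ^ p / ‖x - y‖ ^ ((N : ℝ) - α))


/-- second-order necessary condition -/
lemma second_deriv_nonneg (f f' : ℝ → ℝ) (A : ℝ) (hf : ∀ᶠ t in nhds (0:ℝ), HasDerivAt f (f' t) t)
    (hf' : HasDerivAt f' A 0) (hmin : IsLocalMin f 0) : 0 ≤ A := by
  by_contra hA
  push Not at hA
  have he : deriv f =ᶠ[nhds 0] f' := hf.mono fun t ht => ht.deriv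
  have h2 : deriv (deriv f) 0 = A := by rw [he.deriv_eq]; exact hf'.deriv
  have hmax := isLocalMax_of_deriv_deriv_neg (f := f) (x₀ := 0) (by rw [h2]; exact hA)
    hmin.deriv_eq_zero hf.self_of_nhds.continuousAt
  have hc : f =ᶠ[nhds 0] fun _ => f 0 := by
    filter_upwards [hmin, hmax] with t h1 h2 using le_antisymm h2 h1
  have hd : deriv f =ᶠ[nhds 0] fun _ => 0 := by
    have := hc.deriv
    simpa using this
  have : deriv (deriv f) 0 = 0 := by rw [hd.deriv_eq]; simp
  linarith

abbrev EN (N : ℕ) := EuclideanSpace ℝ (Fin N)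

lemma line_hasDeriv (N : ℕ) (x : EN N) (i : Fin N) (t : ℝ) :
    HasDerivAt (fun t : ℝ => x + t • (EuclideanSpace.single i 1 : EN N)) (EuclideanSpace.single i 1) t := by
  simpa using ((hasDerivAt_id t).smul_const (EuclideanSpace.single i 1 : EN N)).const_add x

lemma line_u (N : ℕ) (u : EN N → ℝ) (x : EN N) (hu : ContDiffAt ℝ 2 u x) (i : Fin N) :
    (∀ᶠ t in nhds (0:ℝ), HasDerivAt (fun t : ℝ => u (x + t • (EuclideanSpace.single i 1 : EN N)))
      (fderiv ℝ u (x + t • (EuclideanSpace.single i 1 : EN N)) (EuclideanSpace.single i 1)) t) ∧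
    HasDerivAt (fun t : ℝ => fderiv ℝ u (x + t • (EuclideanSpace.single i 1 : EN N)) (EuclideanSpace.single i 1))
      (fderiv ℝ (fun y => fderiv ℝ u y (EuclideanSpace.single i 1)) x (EuclideanSpace.single i 1)) 0 := by
  have hx : x + (0:ℝ) • (EuclideanSpace.single i 1 : EN N) = x := by simp
  constructor
  · have h1 : ∀ᶠ y in nhds x, ContDiffAt ℝ 2 u y := hu.eventually (by simp)
    have hc : Filter.Tendsto (fun t : ℝ => x + t • (EuclideanSpace.single i 1 : EN N)) (nhds 0) (nhds x) := by
      have := (line_hasDeriv N x i 0).continuousAt.tendsto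
      rwa [hx] at this
    filter_upwards [hc.eventually h1] with t ht
    exact (ht.differentiableAt (by simp)).hasFDerivAt.comp_hasDerivAt t (line_hasDeriv N x i t)
  · have h1 : ContDiffAt ℝ 1 (fun y => fderiv ℝ u y (EuclideanSpace.single i 1)) x :=
      (hu.fderiv_right (m := 1) (by norm_num)).clm_apply contDiffAt_const
    have h2 := (h1.differentiableAt (by simp)).hasFDerivAt
    have h3 := line_hasDeriv N x i 0
    rw [← hx] at h2
    have := h2.comp_hasDerivAt (0:ℝ) h3
    simpa [Function.comp_def] using this

lemma laplacian_cont (N : ℕ) (u : EN N → ℝ) (x : EN N) (hu : ContDiffAt ℝ 2 u x) :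
    ContinuousAt (laplacian N u) x := by
  unfold laplacian
  refine tendsto_finsetSum _ fun i _ => ?_
  have h1 : ContDiffAt ℝ 1 (fun y => fderiv ℝ u y (EuclideanSpace.single i 1)) x :=
      (hu.fderiv_right (m := 1) (by norm_num)).clm_apply contDiffAt_const
  have h2 : ContDiffAt ℝ 0 (fun y => fderiv ℝ (fun y => fderiv ℝ u y (EuclideanSpace.single i 1)) y (EuclideanSpace.single i 1)) x :=
    (h1.fderiv_right (m := 0) (by norm_num)).clm_apply contDiffAt_const
  exact h2.continuousAt

lemma normsq_line (N : ℕ) (z : EN N) (i : Fin N) (t : ℝ) :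
    ‖z + t • (EuclideanSpace.single i 1 : EN N)‖ ^ 2 = ‖z‖ ^ 2 + 2 * t * z i + t ^ 2 := by
  rw [norm_add_sq_real, inner_smul_right, norm_smul]
  simp [EuclideanSpace.inner_single_right]
  ring

/-- pointwise: comparison function cannot have interior min -/
lemma no_int_min (N : ℕ) (u : EN N → ℝ) (x a : EN N) (hu : ContDiffAt ℝ 2 u x) (hN : 3 ≤ N)
    (hlap : laplacian N u x ≤ 0) (hxa : x ≠ a) (k c ε : ℝ) (hε : 0 < ε)
    (hmin : IsLocalMin (fun y => u y - k * ((‖y - a‖ ^ 2) ^ (-(((N:ℝ) - 2) / 2)) - c)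
      - ε * ‖y - a‖ ^ 2) x) : False := by
  set β : ℝ := ((N:ℝ) - 2) / 2 with hβ
  set z := x - a with hz
  have hz0 : 0 < ‖z‖ ^ 2 := by
    have : z ≠ 0 := sub_ne_zero.2 hxa
    positivity
  have key : ∀ i : Fin N, 0 ≤ fderiv ℝ (fun y => fderiv ℝ u y (EuclideanSpace.single i 1)) x
      (EuclideanSpace.single i 1) -
      k * (β * (β + 1) * (‖z‖ ^ 2) ^ (-β - 2) * (4 * z i ^ 2) - 2 * β * (‖z‖ ^ 2) ^ (-β - 1))
      - ε * 2 := by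
    intro i
    obtain ⟨h1, h2⟩ := line_u N u x hu i
    have hs : ∀ t : ℝ, HasDerivAt (fun t : ℝ => ‖z‖ ^ 2 + 2 * t * z i + t ^ 2) (2 * z i + 2 * t) t := by
      intro t
      have := ((((hasDerivAt_id t).const_mul 2).mul_const (z i)).const_add (‖z‖^2)).add
        (hasDerivAt_pow 2 t)
      exact HasDerivAt.congr_deriv this (by simp)
    have hpos : ∀ᶠ t in nhds (0:ℝ), 0 < ‖z‖ ^ 2 + 2 * t * z i + t ^ 2 := by
      have := (hs 0).continuousAt.tendsto
      simp only [mul_zero, zero_mul, add_zero, ne_eq, OfNat.ofNat_ne_zero, not_false_eq_true, zero_pow] at this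
      exact this.eventually (lt_mem_nhds hz0)
    have hline : ∀ t : ℝ, x + t • (EuclideanSpace.single i 1 : EN N) - a = z + t • EuclideanSpace.single i 1 := by
      intro t; rw [hz]; abel
    refine second_deriv_nonneg
      (fun t => u (x + t • (EuclideanSpace.single i 1 : EN N)) -
        k * ((‖z‖ ^ 2 + 2 * t * z i + t ^ 2) ^ (-β) - c) - ε * (‖z‖ ^ 2 + 2 * t * z i + t ^ 2))
      (fun t => fderiv ℝ u (x + t • (EuclideanSpace.single i 1 : EN N)) (EuclideanSpace.single i 1) -
        k * ((2 * z i + 2 * t) * (-β) * (‖z‖ ^ 2 + 2 * t * z i + t ^ 2) ^ (-β - 1)) - ε * (2 * z i + 2 * t))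
      _ ?_ ?_ ?_
    · filter_upwards [h1, hpos] with t ht hp
      exact (ht.sub ((((hs t).rpow_const (Or.inl hp.ne')).sub_const c).const_mul k)).sub ((hs t).const_mul ε)
    · have hl : HasDerivAt (fun t : ℝ => 2 * z i + 2 * t) 2 0 := by
        simpa using ((hasDerivAt_id (0:ℝ)).const_mul 2).const_add (2 * z i)
      have hr := (hs 0).rpow_const (p := -β - 1) (Or.inl hpos.self_of_nhds.ne')
      have := (h2.sub (((hl.mul_const (-β)).mul hr).const_mul k)).sub (hl.const_mul ε)
      refine HasDerivAt.congr_deriv this ?_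
      simp only [mul_zero, zero_mul, add_zero, ne_eq, OfNat.ofNat_ne_zero, not_false_eq_true, zero_pow]
      rw [show -β - 1 - 1 = -β - 2 by ring]
      ring
    · have hc : Filter.Tendsto (fun t : ℝ => x + t • (EuclideanSpace.single i 1 : EN N)) (nhds 0) (nhds x) := by
        have := (line_hasDeriv N x i 0).continuousAt.tendsto
        simpa using this
      have := hc.eventually hmin
      refine this.mono fun t ht => ?_
      simp only [hline, normsq_line] at ht
      simpa using ht
  have hsum := Finset.sum_nonneg fun i (_ : i ∈ Finset.univ) => key i
  have hnorm : ∑ i, z i ^ 2 = ‖z‖ ^ 2 := by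
    rw [EuclideanSpace.norm_sq_eq]; simp
  rw [Finset.sum_sub_distrib, Finset.sum_sub_distrib, ← Finset.mul_sum, Finset.sum_sub_distrib,
    ← Finset.mul_sum, ← Finset.mul_sum, hnorm] at hsum
  simp only [Finset.sum_const, Finset.card_univ, Fintype.card_fin, nsmul_eq_mul] at hsum
  have hpw : (‖z‖ ^ 2) ^ (-β - 1) = (‖z‖ ^ 2) ^ (-β - 2) * ‖z‖ ^ 2 := by
    rw [← Real.rpow_add_one hz0.ne']; ring_nf
  have hNr : (N:ℝ) = 2 * β + 2 := by rw [hβ]; ring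
  have hNp : (0:ℝ) < N := by positivity
  have hzero : β * (β + 1) * (‖z‖ ^ 2) ^ (-β - 2) * (4 * ‖z‖ ^ 2) - N * (2 * β * (‖z‖ ^ 2) ^ (-β - 1)) = 0 := by
    rw [hpw, hNr]; ring
  rw [hzero] at hsum
  have : laplacian N u x - k * 0 - N * (ε * 2) ≥ 0 := hsum
  have : 0 < N * (ε * 2) := by positivity
  linarith

lemma annulus_comp (N : ℕ) (hN : 3 ≤ N) (u : EN N → ℝ) (a : EN N) (s r k : ℝ) (hs : 0 < s)
    (hk : 0 ≤ k)
    (hu : ∀ x, s ≤ ‖x - a‖ → ‖x - a‖ ≤ r → ContDiffAt ℝ 2 u x)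
    (hlap : ∀ x, s ≤ ‖x - a‖ → ‖x - a‖ ≤ r → laplacian N u x ≤ 0)
    (h0 : ∀ x, s ≤ ‖x - a‖ → ‖x - a‖ ≤ r → 0 ≤ u x)
    (hin : ∀ x, ‖x - a‖ = s → k * (s ^ 2) ^ (-(((N:ℝ) - 2) / 2)) ≤ u x)
    (x : EN N) (hx1 : s ≤ ‖x - a‖) (hx2 : ‖x - a‖ ≤ r) :
    k * ((‖x - a‖ ^ 2) ^ (-(((N:ℝ) - 2) / 2)) - (r ^ 2) ^ (-(((N:ℝ) - 2) / 2))) ≤ u x := by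
  set β : ℝ := ((N:ℝ) - 2) / 2 with hβ
  have hr : 0 < r := by linarith
  refine le_of_forall_pos_le_add fun δ hδ => ?_
  set ε := δ / r ^ 2 with hε
  have hεp : 0 < ε := by positivity
  have hεr : ε * r ^ 2 = δ := by rw [hε]; field_simp
  let v : EN N → ℝ := fun y => u y - k * ((‖y - a‖ ^ 2) ^ (-β) - (r ^ 2) ^ (-β)) - ε * ‖y - a‖ ^ 2
  let K : Set (EN N) := {y | s ≤ ‖y - a‖ ∧ ‖y - a‖ ≤ r}
  have hcn : Continuous fun y : EN N => ‖y - a‖ := by fun_prop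
  have hK : IsCompact K := by
    refine (isCompact_closedBall a r).of_isClosed_subset ?_ ?_
    · exact (isClosed_le continuous_const hcn).inter (isClosed_le hcn continuous_const)
    · intro y hy; rw [mem_closedBall_iff_norm]; exact hy.2
  have hv : ContinuousOn v K := by
    intro y hy
    have h1 : ContinuousAt u y := (hu y hy.1 hy.2).continuousAt
    have h2 : ContinuousAt (fun y : EN N => (‖y - a‖ ^ 2) ^ (-β)) y := by
      refine ContinuousAt.rpow_const (by fun_prop) (Or.inl ?_)
      have : 0 < ‖y - a‖ := by linarith [hy.1]
      positivity
    have h3 : ContinuousAt (fun y : EN N => ε * ‖y - a‖ ^ 2) y := by fun_prop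
    exact ((h1.sub ((h2.sub continuousAt_const).const_mul k)).sub h3).continuousWithinAt
  obtain ⟨y, hyK, hy⟩ := hK.exists_isMinOn ⟨x, hx1, hx2⟩ hv
  have hxy : v y ≤ v x := hy ⟨hx1, hx2⟩
  have hvy : -δ ≤ v y := by
    have hεy : ε * ‖y - a‖ ^ 2 ≤ δ := by
      rw [← hεr]
      have := hyK.2
      gcongr
    rcases eq_or_lt_of_le hyK.1 with h | h
    · have h1 := hin y h.symm
      have h2 : 0 ≤ k * (r ^ 2) ^ (-β) := by positivity
      simp only [v]
      rw [← h] at hεy ⊢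
      linarith
    · rcases eq_or_lt_of_le hyK.2 with h' | h'
      · have h1 := h0 y hyK.1 hyK.2
        simp only [v]
        rw [h'] at hεy ⊢
        linarith
      · exfalso
        refine no_int_min N u y a (hu y hyK.1 hyK.2) hN (hlap y hyK.1 hyK.2) ?_ k _ ε hεp
          (IsMinOn.isLocalMin hy ?_)
        · rintro rfl
          simp at h; linarith
        · have : IsOpen {y : EN N | s < ‖y - a‖ ∧ ‖y - a‖ < r} :=
            (isOpen_lt continuous_const hcn).inter (isOpen_lt hcn continuous_const)
          exact Filter.mem_of_superset (this.mem_nhds ⟨h, h'⟩) fun w hw => ⟨hw.1.le, hw.2.le⟩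
  have h4 : 0 ≤ ε * ‖x - a‖ ^ 2 := by positivity
  simp only [v] at hxy hvy
  linarith

lemma ext_preconnected (N : ℕ) (hN : 3 ≤ N) (ρ : ℝ) (hρ : 0 < ρ) :
    IsPreconnected {x : EN N | ρ < ‖x‖} := by
  have hrank : 1 < Module.rank ℝ (EN N) := by
    apply Module.one_lt_rank_of_one_lt_finrank
    simp; omega
  have h1 := isPreconnected_sphere hrank (0 : EN N) 1
  have h2 : IsPreconnected (Set.Ioi ρ) := isPreconnected_Ioi
  have h3 := (h2.prod h1).image (fun q : ℝ × EN N => q.1 • q.2) (by fun_prop)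
  convert h3 using 1
  ext x
  simp only [Set.mem_ofPred_eq, Set.mem_image, Set.mem_prod, Set.mem_Ioi, mem_sphere_iff_norm, sub_zero, Prod.exists]
  constructor
  · intro hx
    have hx0 : ‖x‖ ≠ 0 := by linarith
    refine ⟨‖x‖, ‖x‖⁻¹ • x, ⟨hx, ?_⟩, ?_⟩
    · rw [norm_smul]; simp [hx0]
    · rw [smul_smul, mul_inv_cancel₀ hx0, one_smul]
  · rintro ⟨t, y, ⟨ht, hy⟩, rfl⟩
    rw [norm_smul, hy, mul_one, Real.norm_of_nonneg (by linarith)]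
    exact ht

lemma lintegral_div (N : ℕ) (hN : 3 ≤ N) (R : ℝ) (hR : 0 < R) :
    ∫⁻ x : EN N, ENNReal.ofReal ((Set.Ici R).indicator (fun y : ℝ => y ^ (-(N:ℝ))) ‖x‖) = ⊤ := by
  set f : ℝ → ℝ := (Set.Ici R).indicator (fun y : ℝ => y ^ (-(N:ℝ))) with hf
  have hfm : Measurable f := (by fun_prop : Measurable (fun y : ℝ => y ^ (-(N:ℝ)))).indicator measurableSet_Ici
  have hf0 : ∀ y, 0 ≤ f y := by
    intro y
    refine Set.indicator_nonneg (fun y hy => ?_) y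
    have : 0 < y := lt_of_lt_of_le hR hy
    positivity
  by_contra h
  have hint : Integrable (fun x : EN N => f ‖x‖) volume :=
    (lintegral_ofReal_ne_top_iff_integrable (hfm.comp measurable_norm).aestronglyMeasurable
      (Filter.Eventually.of_forall fun x => hf0 _)).1 h
  have : Nontrivial (EN N) := Module.nontrivial_of_finrank_pos (R := ℝ) (by simp; omega)
  rw [integrable_fun_norm_addHaar volume (f := f)] at hint
  have h2 : IntegrableOn (fun y : ℝ => y⁻¹) (Set.Ioi R) := by
    refine (hint.mono_set (Set.Ioi_subset_Ioi hR.le)).congr_fun ?_ measurableSet_Ioi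
    intro y hy
    have hy0 : 0 < y := lt_trans hR hy
    have : f y = y ^ (-(N:ℝ)) := Set.indicator_of_mem (Set.mem_Ici.2 (le_of_lt hy)) _
    simp only [this, finrank_euclideanSpace, Fintype.card_fin, smul_eq_mul]
    rw [← Real.rpow_natCast, ← Real.rpow_add hy0, Nat.cast_sub (by omega), ← Real.rpow_neg_one]
    congr 1; push_cast; ring
  exact not_integrableOn_Ioi_inv h2

lemma strong_min (N : ℕ) (hN : 3 ≤ N) (ρ : ℝ) (hρ : 0 < ρ) (u : EN N → ℝ)
    (hu : ∀ x, ρ < ‖x‖ → ContDiffAt ℝ 2 u x)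
    (hlap : ∀ x, ρ < ‖x‖ → laplacian N u x ≤ 0)
    (h0 : ∀ x, ρ < ‖x‖ → 0 ≤ u x) (x1 : EN N) (hx1 : ρ < ‖x1‖) (hux1 : 0 < u x1) :
    ∀ x, ρ < ‖x‖ → 0 < u x := by
  have hopen : IsOpen {x : EN N | ρ < ‖x‖} := isOpen_lt continuous_const continuous_norm
  have hcont : ContinuousOn u {x : EN N | ρ < ‖x‖} := fun x hx => (hu x hx).continuousAt.continuousWithinAt
  let S : Set (EN N) := {x | ρ < ‖x‖} ∩ u ⁻¹' Set.Ioi 0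
  have hS : IsOpen S := hcont.isOpen_inter_preimage hopen isOpen_Ioi
  have hsub : {x : EN N | ρ < ‖x‖} ⊆ S := by
    refine (ext_preconnected N hN ρ hρ).subset_of_closure_inter_subset hS ⟨x1, hx1, hx1, hux1⟩ ?_
    rintro y ⟨hyc, hy⟩
    have hy' : ρ < ‖y‖ := hy
    set r := (‖y‖ - ρ) / 3 with hr
    have hr0 : 0 < r := by rw [hr]; linarith
    obtain ⟨a, haS, hay⟩ := Metric.mem_closure_iff.1 hyc r hr0
    rw [dist_eq_norm] at hay
    refine ⟨hy, ?_⟩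
    have hball : ∀ x : EN N, ‖x - a‖ ≤ r → ρ < ‖x‖ := by
      intro x hx
      have h1 : ‖y‖ ≤ ‖y - a‖ + ‖a - x‖ + ‖x‖ := by
        calc ‖y‖ = ‖(y - a) + (a - x) + x‖ := by congr 1; abel
          _ ≤ _ := norm_add₃_le
      rw [norm_sub_rev a x] at h1
      linarith
    have hua : 0 < u a := haS.2
    have hca : ContinuousAt u a := (hu a haS.1).continuousAt
    obtain ⟨δ, hδ, hδu⟩ := Metric.eventually_nhds_iff.1 (hca.eventually (lt_mem_nhds (half_lt_self hua)))
    set s := min (δ / 2) (r / 2) with hs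
    have hs0 : 0 < s := by positivity
    have hsδ : s < δ := by have := min_le_left (δ/2) (r/2); linarith
    by_cases hcase : ‖y - a‖ < s
    · have : u a / 2 < u y := hδu (by rw [dist_eq_norm]; linarith)
      show 0 < u y
      linarith
    · push Not at hcase
      set β : ℝ := ((N:ℝ) - 2) / 2 with hβ
      have hβ0 : 0 < β := by
        have : (3:ℝ) ≤ N := by exact_mod_cast hN
        rw [hβ]; linarith
      have hsp : 0 < (s ^ 2) ^ (-β) := by positivity
      have := annulus_comp N hN u a s r (u a / 2 / (s ^ 2) ^ (-β)) hs0 (by positivity)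
        (fun x _ h => hu x (hball x h)) (fun x _ h => hlap x (hball x h)) (fun x _ h => h0 x (hball x h))
        (fun x hx => by
          rw [div_mul_cancel₀ _ hsp.ne']
          exact (hδu (by rw [dist_eq_norm, hx]; exact hsδ)).le) y hcase hay.le
      refine lt_of_lt_of_le ?_ this
      have hya : 0 < ‖y - a‖ := by linarith
      have : (r ^ 2) ^ (-β) < (‖y - a‖ ^ 2) ^ (-β) := by
        apply Real.rpow_lt_rpow_of_neg (by positivity) (by gcongr) (by linarith)
      have h5 : 0 < (‖y - a‖ ^ 2) ^ (-β) - (r ^ 2) ^ (-β) := by linarith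
      positivity
  exact fun x hx => (hsub hx).2

lemma lower_bound (N : ℕ) (hN : 3 ≤ N) (ρ : ℝ) (hρ : 0 < ρ) (u : EN N → ℝ)
    (hu : ∀ x, ρ < ‖x‖ → ContDiffAt ℝ 2 u x)
    (hlap : ∀ x, ρ < ‖x‖ → laplacian N u x ≤ 0)
    (h0 : ∀ x, ρ < ‖x‖ → 0 < u x) :
    ∃ c > 0, ∀ x, ρ + 1 ≤ ‖x‖ → c * ‖x‖ ^ (-((N:ℝ) - 2)) ≤ u x := by
  set R := ρ + 1 with hR
  have hR0 : 0 < R := by linarith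
  have : Nontrivial (EN N) := Module.nontrivial_of_finrank_pos (R := ℝ) (by simp; omega)
  obtain ⟨y, hy, hmin⟩ := (isCompact_sphere (0 : EN N) R).exists_isMinOn (f := u)
    (NormedSpace.sphere_nonempty.2 hR0.le)
    (fun x hx => (hu x (by rw [mem_sphere_iff_norm, sub_zero] at hx; linarith)).continuousAt.continuousWithinAt)
  have hm : 0 < u y := h0 y (by rw [mem_sphere_iff_norm, sub_zero] at hy; linarith)
  set β : ℝ := ((N:ℝ) - 2) / 2 with hβ
  have hN3 : (3:ℝ) ≤ N := by exact_mod_cast hN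
  have hsp : 0 < (R ^ 2) ^ (-β) := by positivity
  refine ⟨u y / (R ^ 2) ^ (-β) / 2, by positivity, fun x hx => ?_⟩
  have hx0 : 0 < ‖x‖ := by linarith
  have := annulus_comp N hN u 0 R (2 * ‖x‖) (u y / (R ^ 2) ^ (-β)) hR0 (by positivity)
        (fun x h _ => hu x (by rw [sub_zero] at h; linarith))
        (fun x h _ => hlap x (by rw [sub_zero] at h; linarith))
        (fun x h _ => (h0 x (by rw [sub_zero] at h; linarith)).le)
        (fun x hx => by
          rw [div_mul_cancel₀ _ hsp.ne']
          exact hmin (by rw [mem_sphere_iff_norm]; exact hx)) x (by rwa [sub_zero]) (by rw [sub_zero]; linarith)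
  refine le_trans ?_ this
  have e : ∀ t : ℝ, 0 < t → (t ^ 2) ^ (-β) = t ^ (-((N:ℝ) - 2)) := by
    intro t ht
    rw [← Real.rpow_natCast, ← Real.rpow_mul ht.le]
    congr 1; rw [hβ]; push_cast; ring
  rw [sub_zero, ← hβ, e _ hx0, e (2 * ‖x‖) (by positivity), Real.mul_rpow (by norm_num) hx0.le, div_mul_eq_mul_div,
    mul_div_assoc]
  have h2 : (2:ℝ) ^ (-((N:ℝ) - 2)) ≤ 1 / 2 := by
    calc (2:ℝ) ^ (-((N:ℝ) - 2)) ≤ 2 ^ (-1 : ℝ) := Real.rpow_le_rpow_of_exponent_le (by norm_num) (by linarith)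
      _ = 1 / 2 := by rw [Real.rpow_neg_one]; norm_num
  have h3 : 0 < ‖x‖ ^ (-((N:ℝ) - 2)) := by positivity
  gcongr
  nlinarith

lemma superharm (N : ℕ) (α ρ p q : ℝ) (hα : 0 < α) (hαN : α < N) (u : EN N → ℝ)
    (hN : 3 ≤ N)
    (hreg : ContDiffOn ℝ 2 u {x : EN N | ρ ≤ ‖x‖})
    (hu : ∀ x, ρ < ‖x‖ → ContDiffAt ℝ 2 u x)
    (h0 : ∀ x : EN N, ρ ≤ ‖x‖ → 0 ≤ u x)
    (hineq : ∀ x : EN N, ρ ≤ ‖x‖ →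
      rieszConvExt N α ρ p u x * ENNReal.ofReal (u x ^ q) ≤
        ENNReal.ofReal (-(laplacian N u x)))
    (x1 : EN N) (hx1 : ρ < ‖x1‖) (hux1 : 0 < u x1) :
    ∀ x, ρ < ‖x‖ → laplacian N u x ≤ 0 := by
  have hopen : IsOpen {x : EN N | ρ < ‖x‖} := isOpen_lt continuous_const continuous_norm
  have hcont : ContinuousOn u {x : EN N | ρ < ‖x‖} := fun x hx => (hu x hx).continuousAt.continuousWithinAt
  let S : Set (EN N) := {x | ρ < ‖x‖} ∩ u ⁻¹' Set.Ioi 0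
  have hS : IsOpen S := hcont.isOpen_inter_preimage hopen isOpen_Ioi
  have hE : MeasurableSet {x : EN N | ρ ≤ ‖x‖} := (isClosed_le continuous_const continuous_norm).measurableSet
  have : Nontrivial (EN N) := Module.nontrivial_of_finrank_pos (R := ℝ) (by simp; omega)
  have hA : 0 < rieszConst N α := by
    unfold rieszConst
    have h1 : 0 < Real.Gamma (((N:ℝ) - α) / 2) := Real.Gamma_pos_of_pos (by linarith)
    have h2 : 0 < Real.Gamma (α / 2) := Real.Gamma_pos_of_pos (by linarith)
    have := Real.pi_pos
    positivity
  have hconv : ∀ x, rieszConvExt N α ρ p u x ≠ 0 := by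
    intro x hx
    unfold rieszConvExt at hx
    have hum : AEMeasurable u (volume.restrict {x : EN N | ρ ≤ ‖x‖}) := hreg.continuousOn.aemeasurable hE
    rw [lintegral_eq_zero_iff' (by fun_prop)] at hx
    have hx' := (ae_restrict_iff' hE).1 hx
    have hpos : 0 < volume (S \ {x}) := by
      rw [measure_sdiff_null (by simp)]
      exact hS.measure_pos volume ⟨x1, hx1, hux1⟩
    refine hpos.ne' (measure_mono_null ?_ hx')
    rintro y ⟨⟨hy1, hy2⟩, hyx⟩ hcon
    have h3 := hcon (show ρ ≤ ‖y‖ from le_of_lt hy1)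
    simp only [Pi.zero_apply, ENNReal.ofReal_eq_zero] at h3
    have hy2' : 0 < u y := hy2
    have hxy : 0 < ‖x - y‖ := norm_pos_iff.2 (sub_ne_zero.2 fun h => hyx h.symm)
    have : 0 < rieszConst N α * u y ^ p / ‖x - y‖ ^ ((N : ℝ) - α) := by positivity
    linarith
  have hSlap : ∀ x ∈ S, laplacian N u x ≤ 0 := by
    intro x hx
    by_contra hc
    push Not at hc
    have h1 := hineq x (le_of_lt hx.1)
    rw [ENNReal.ofReal_of_nonpos (p := -(laplacian N u x)) (by linarith), nonpos_iff_eq_zero, mul_eq_zero] at h1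
    rcases h1 with h1 | h1
    · exact hconv x h1
    · rw [ENNReal.ofReal_eq_zero] at h1
      have h4 : 0 < u x := hx.2
      have : 0 < u x ^ q := by positivity
      linarith
  intro x hx
  by_cases hxc : x ∈ closure S
  · by_contra hc
    push Not at hc
    have h1 := (laplacian_cont N u x (hu x hx)).eventually (lt_mem_nhds hc)
    obtain ⟨y, hy, hyS⟩ := mem_closure_iff_nhds.1 hxc _ h1
    exact absurd (hSlap y hyS) (not_le.2 hy)
  · have hz : u =ᶠ[nhds x] fun _ => 0 := by
      filter_upwards [hopen.mem_nhds hx, isClosed_closure.isOpen_compl.mem_nhds hxc] with y hy hyS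
      by_contra hne
      exact hyS (subset_closure ⟨hy, lt_of_le_of_ne (h0 y (le_of_lt hy)) (Ne.symm hne)⟩)
    refine le_of_eq ?_
    unfold laplacian
    refine Finset.sum_eq_zero fun i _ => ?_
    have h1 : (fun y => fderiv ℝ u y (EuclideanSpace.single i 1)) =ᶠ[nhds x] fun _ => 0 := by
      filter_upwards [hz.fderiv (𝕜 := ℝ)] with y hy
      rw [hy]; simp
    rw [h1.fderiv_eq]; simp

/-- Let `N ≥ 3`, `α ∈ (0,N)`, `ρ > 0`, `0 < p ≤ α/(N-2)`. If `u ≥ 0` is a classical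
solution of `-Δu ≥ (I_α ∗ u^p) u^q` in `ℝ^N \ B_ρ` with
`u ∈ L^p(ℝ^N \ B_ρ, |x|^{-(N-α)}dx)`, then `u ≡ 0` there. -/
theorem stmt10 (N : ℕ) (hN : 3 ≤ N) (α ρ p q : ℝ) (hα : 0 < α) (hαN : α < N) (hρ : 0 < ρ)
    (hp : 0 < p) (hpα : p ≤ α / ((N : ℝ) - 2))
    (u : EuclideanSpace ℝ (Fin N) → ℝ)
    (hreg : ContDiffOn ℝ 2 u {x : EuclideanSpace ℝ (Fin N) | ρ ≤ ‖x‖})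
    (h0 : ∀ x : EuclideanSpace ℝ (Fin N), ρ ≤ ‖x‖ → 0 ≤ u x)
    (hLp : (∫⁻ y in {y : EuclideanSpace ℝ (Fin N) | ρ ≤ ‖y‖},
        ENNReal.ofReal (u y ^ p * ‖y‖ ^ (-((N : ℝ) - α)))) < ⊤)
    (hineq : ∀ x : EuclideanSpace ℝ (Fin N), ρ ≤ ‖x‖ →
      rieszConvExt N α ρ p u x * ENNReal.ofReal (u x ^ q) ≤
        ENNReal.ofReal (-(laplacian N u x))) :
    ∀ x : EuclideanSpace ℝ (Fin N), ρ ≤ ‖x‖ → u x = 0 := by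
  by_contra hcon
  push Not at hcon
  obtain ⟨x0, hx0, hux0⟩ := hcon
  have hux0p : 0 < u x0 := lt_of_le_of_ne (h0 x0 hx0) (Ne.symm hux0)
  have hopen : IsOpen {x : EN N | ρ < ‖x‖} := isOpen_lt continuous_const continuous_norm
  have hu : ∀ x, ρ < ‖x‖ → ContDiffAt ℝ 2 u x := fun x hx =>
    hreg.contDiffAt (Filter.mem_of_superset (hopen.mem_nhds hx) fun y hy => show ρ ≤ ‖y‖ from le_of_lt hy)
  obtain ⟨x1, hx1, hux1⟩ : ∃ x1 : EN N, ρ < ‖x1‖ ∧ 0 < u x1 := by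
    have hnorm : ∀ t : ℝ, 0 < t → ρ < ‖(1 + t) • x0‖ := by
      intro t ht
      rw [norm_smul, Real.norm_of_nonneg (by linarith)]
      nlinarith
    have htend : Filter.Tendsto (fun t : ℝ => (1 + t) • x0) (nhdsWithin 0 (Set.Ioi 0))
        (nhdsWithin x0 {x : EN N | ρ ≤ ‖x‖}) := by
      refine tendsto_nhdsWithin_iff.2 ⟨?_, ?_⟩
      · have hc : Continuous fun t : ℝ => (1 + t) • x0 := by fun_prop
        have := hc.tendsto 0
        simp only [add_zero, one_smul] at this
        exact this.mono_left nhdsWithin_le_nhds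
      · filter_upwards [self_mem_nhdsWithin] with t ht
        exact (hnorm t ht).le
    have h1 := ((hreg.continuousOn x0 hx0).tendsto.comp htend).eventually (lt_mem_nhds hux0p)
    obtain ⟨t, ht1, ht2⟩ := (h1.and self_mem_nhdsWithin).exists
    exact ⟨_, hnorm t ht2, ht1⟩
  have hlap := superharm N α ρ p q hα hαN u hN hreg hu h0 hineq x1 hx1 hux1
  have hpos := strong_min N hN ρ hρ u hu hlap (fun x hx => h0 x hx.le) x1 hx1 hux1
  obtain ⟨c, hc, hlow⟩ := lower_bound N hN ρ hρ u hu hlap hpos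
  have hN3 : (3:ℝ) ≤ N := by exact_mod_cast hN
  have hpN : p * ((N:ℝ) - 2) ≤ α := by
    rwa [le_div_iff₀ (by linarith)] at hpα
  have hcp : 0 < c ^ p := by positivity
  have hE : MeasurableSet {x : EN N | ρ ≤ ‖x‖} :=
    (isClosed_le continuous_const continuous_norm).measurableSet
  refine hLp.ne (top_le_iff.1 ?_)
  calc (⊤ : ℝ≥0∞) = ENNReal.ofReal (c ^ p) * ⊤ := by
        rw [ENNReal.mul_top]
        simpa using hcp
    _ = ENNReal.ofReal (c ^ p) * ∫⁻ x : EN N, ENNReal.ofReal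
          ((Set.Ici (ρ + 1)).indicator (fun y : ℝ => y ^ (-(N:ℝ))) ‖x‖) := by
        rw [lintegral_div N hN (ρ + 1) (by linarith)]
    _ = ∫⁻ x : EN N, ENNReal.ofReal (c ^ p) * ENNReal.ofReal
          ((Set.Ici (ρ + 1)).indicator (fun y : ℝ => y ^ (-(N:ℝ))) ‖x‖) := by
        rw [lintegral_const_mul' _ _ ENNReal.ofReal_ne_top]
    _ ≤ ∫⁻ x : EN N, ({y : EN N | ρ ≤ ‖y‖}).indicator
          (fun y => ENNReal.ofReal (u y ^ p * ‖y‖ ^ (-((N : ℝ) - α)))) x := by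
        refine lintegral_mono fun x => ?_
        by_cases hx : ρ + 1 ≤ ‖x‖
        · rw [Set.indicator_of_mem (Set.mem_Ici.2 hx),
            Set.indicator_of_mem (show x ∈ {y : EN N | ρ ≤ ‖y‖} from by
              show ρ ≤ ‖x‖; linarith), ← ENNReal.ofReal_mul hcp.le]
          apply ENNReal.ofReal_le_ofReal
          have hx0 : 0 < ‖x‖ := by linarith
          have hx1 : 1 ≤ ‖x‖ := by linarith
          have e1 : ‖x‖ ^ (-(N:ℝ)) = ‖x‖ ^ (-α) * ‖x‖ ^ (-((N : ℝ) - α)) := by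
            rw [← Real.rpow_add hx0]; congr 1; ring
          rw [e1, ← mul_assoc]
          gcongr
          calc c ^ p * ‖x‖ ^ (-α) ≤ c ^ p * ‖x‖ ^ (-((N:ℝ) - 2) * p) := by
                gcongr
                linarith
            _ = (c * ‖x‖ ^ (-((N:ℝ) - 2))) ^ p := by
                rw [Real.mul_rpow hc.le (by positivity), ← Real.rpow_mul hx0.le]
            _ ≤ u x ^ p := by
                have := hlow x hx
                gcongr
        · rw [Set.indicator_of_notMem (by simpa using hx)]
          simp
    _ = _ := lintegral_indicator hE _
end
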